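/- For every positive integer n and every positive integer j, the number of compositions (c_1,…,c_t) of n satisfying c_{2i-1} > c_{2i} − 2j for every index i with 2i ≤ t equals the number of compositions of n each of whose parts is either odd or an even number belonging to {2, 4, …, 2j}. -/

import Mathlib

/-- A composition of `n`: a list of positive integers summing to `n`. -/
def IsComposition (n : ℕ) (l : List ℕ) : Prop :=
  (∀ x ∈ l, 0 < x) ∧ l.sum = n

/-- The number of ones preceding the part larger than one that encodes the pair `(a, b)`. -/
def pairOnes (a b : ℕ) : ℕ :=
  if a ≤ b then 2 * a - 2 + (a + b) % 2 else 2 * b - 2 + (a + b + 1) % 2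

/-- Replace each pair `(a, b)` of consecutive parts by a run of ones followed by a part larger than
one, and a final unpaired part by a run of ones. -/
def splitPairs : List ℕ → List ℕ
  | [] => []
  | [a] => List.replicate a 1
  | a :: b :: l => List.replicate (pairOnes a b) 1 ++ (a + b - pairOnes a b) :: splitPairs l

/-- Inverse of `splitPairs`; the argument `k` counts the ones read since the last part larger
than one. -/
def mergeOnes (k : ℕ) : List ℕ → List ℕ
  | [] => if k = 0 then [] else [k]
  | c :: l =>
    if c = 1 then mergeOnes (k + 1) l
    else if Even c then (k / 2 + 1) :: (k + c - (k / 2 + 1)) :: mergeOnes 0 l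
    else (k + c - (k / 2 + 1)) :: (k / 2 + 1) :: mergeOnes 0 l

theorem pairOnes_add_two_le {a b : ℕ} (ha : 0 < a) (hb : 0 < b) :
    pairOnes a b + 2 ≤ a + b := by
  unfold pairOnes; split_ifs <;> omega

theorem mergeOnes_replicate_append (k m : ℕ) (l : List ℕ) :
    mergeOnes k (List.replicate m 1 ++ l) = mergeOnes (k + m) l := by
  induction m generalizing k with
  | zero => simp
  | succ m ih =>
    rw [List.replicate_succ, List.cons_append, mergeOnes, if_pos rfl, ih]
    congr 1; omega

theorem mergeOnes_splitPairs (l : List ℕ) (hl : ∀ x ∈ l, 0 < x) :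
    mergeOnes 0 (splitPairs l) = l := by
  induction l using splitPairs.induct with
  | case1 => simp [splitPairs, mergeOnes]
  | case2 a =>
    have ha : a ≠ 0 := (hl a (by simp)).ne'
    have h := mergeOnes_replicate_append 0 a []
    rw [List.append_nil] at h
    simp [splitPairs, h, mergeOnes, ha]
  | case3 a b l ih =>
    have ha := hl a (by simp)
    have hb := hl b (by simp)
    have hk := pairOnes_add_two_le ha hb
    rw [splitPairs, mergeOnes_replicate_append, mergeOnes, ih fun x hx => hl x (by simp [hx]),
      if_neg (by omega)]
    split_ifs with h <;> simp only [Nat.even_iff, List.cons.injEq, and_true] at h ⊢ <;>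
      unfold pairOnes at * <;> split_ifs at * <;> omega

theorem splitPairs_mergeOnes (k : ℕ) (l : List ℕ) (hl : ∀ x ∈ l, 0 < x) :
    splitPairs (mergeOnes k l) = List.replicate k 1 ++ l := by
  induction l generalizing k with
  | nil => by_cases h : k = 0 <;> simp [mergeOnes, splitPairs, h]
  | cons c l ih =>
    have hc := hl c (by simp)
    have hl' : ∀ x ∈ l, 0 < x := fun x hx => hl x (by simp [hx])
    rw [mergeOnes]
    split_ifs with h1 h2
    · rw [ih _ hl', h1, List.replicate_succ', List.append_assoc, List.singleton_append]
    · have hk : pairOnes (k / 2 + 1) (k + c - (k / 2 + 1)) = k := by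
        rw [Nat.even_iff] at h2
        unfold pairOnes; split_ifs <;> omega
      rw [splitPairs, hk, ih _ hl', List.replicate_zero, List.nil_append]
      congr 2; omega
    · have hk : pairOnes (k + c - (k / 2 + 1)) (k / 2 + 1) = k := by
        rw [Nat.even_iff] at h2
        unfold pairOnes; split_ifs <;> omega
      rw [splitPairs, hk, ih _ hl', List.replicate_zero, List.nil_append]
      congr 2; omega

theorem sum_splitPairs (l : List ℕ) (hl : ∀ x ∈ l, 0 < x) : (splitPairs l).sum = l.sum := by
  induction l using splitPairs.induct with
  | case1 => rfl
  | case2 a => simp [splitPairs]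
  | case3 a b l ih =>
    have hk := pairOnes_add_two_le (hl a (by simp)) (hl b (by simp))
    have := ih fun x hx => hl x (by simp [hx])
    simp only [splitPairs, List.sum_append, List.sum_replicate, List.sum_cons, smul_eq_mul]
    omega

theorem pos_of_mem_splitPairs (l : List ℕ) (hl : ∀ x ∈ l, 0 < x) :
    ∀ x ∈ splitPairs l, 0 < x := by
  induction l using splitPairs.induct with
  | case1 => simp [splitPairs]
  | case2 a => simp [splitPairs]
  | case3 a b l ih =>
    have hk := pairOnes_add_two_le (hl a (by simp)) (hl b (by simp))
    intro x hx
    simp only [splitPairs, List.mem_append, List.mem_replicate, List.mem_cons] at hx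
    rcases hx with hx | hx | hx
    · omega
    · omega
    · exact ih (fun x hx => hl x (by simp [hx])) x hx

theorem pos_of_mem_mergeOnes (k : ℕ) (l : List ℕ) (hl : ∀ x ∈ l, 0 < x) :
    ∀ x ∈ mergeOnes k l, 0 < x := by
  induction l generalizing k with
  | nil => by_cases h : k = 0 <;> simp [mergeOnes, h, Nat.pos_iff_ne_zero]
  | cons c l ih =>
    have hc := hl c (by simp)
    have hl' : ∀ x ∈ l, 0 < x := fun x hx => hl x (by simp [hx])
    intro x hx
    rw [mergeOnes] at hx
    split_ifs at hx with h1 h2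
    · exact ih _ hl' x hx
    all_goals
      simp only [List.mem_cons] at hx
      rcases hx with hx | hx | hx
      · omega
      · omega
      · exact ih _ hl' x hx

theorem forall_pair_getD_cons_cons (p : ℕ → ℕ → Prop) (a b : ℕ) (l : List ℕ) :
    (∀ i : ℕ, 2 * i + 1 < (a :: b :: l).length →
        p ((a :: b :: l).getD (2 * i) 0) ((a :: b :: l).getD (2 * i + 1) 0)) ↔
      p a b ∧ ∀ i : ℕ, 2 * i + 1 < l.length → p (l.getD (2 * i) 0) (l.getD (2 * i + 1) 0) := by
  constructor
  · refine fun h => ⟨by simpa using h 0, fun i hi => ?_⟩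
    simpa [Nat.mul_add] using h (i + 1) (by simp only [List.length_cons]; omega)
  · rintro ⟨h0, h⟩ (_ | i) hi
    · simpa using h0
    · simpa [Nat.mul_add] using h i (by simp only [List.length_cons] at hi; omega)

theorem forall_mem_splitPairs_iff (j : ℕ) (l : List ℕ) (hl : ∀ x ∈ l, 0 < x) :
    (∀ x ∈ splitPairs l, Odd x ∨ (Even x ∧ x ≤ 2 * j)) ↔
      ∀ i : ℕ, 2 * i + 1 < l.length → l.getD (2 * i + 1) 0 < l.getD (2 * i) 0 + 2 * j := by
  induction l using splitPairs.induct with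
  | case1 => simp [splitPairs]
  | case2 a => simp [splitPairs]
  | case3 a b l ih =>
    have ha := hl a (by simp)
    have hb := hl b (by simp)
    rw [forall_pair_getD_cons_cons (fun a b => b < a + 2 * j),
      ← ih fun x hx => hl x (by simp [hx])]
    have hpair : (Odd (a + b - pairOnes a b) ∨
        (Even (a + b - pairOnes a b) ∧ a + b - pairOnes a b ≤ 2 * j)) ↔ b < a + 2 * j := by
      rw [Nat.odd_iff, Nat.even_iff]
      unfold pairOnes; split_ifs <;> omega
    simp only [splitPairs, List.forall_mem_append, List.forall_mem_cons, hpair]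
    refine and_iff_right fun x hx => Or.inl ?_
    rw [List.eq_of_mem_replicate hx]
    exact odd_one

/-- For positive `n` and `j`, the number of compositions of `n` with
`c_{2i-1} > c_{2i} - 2j` for each pair equals the number of compositions of
`n` whose parts are all odd or even numbers in `{2, 4, …, 2j}`. -/
theorem arndt_neg_even_count (n j : ℕ) (hn : 0 < n) (hj : 0 < j) :
    Nat.card {l : List ℕ // IsComposition n l ∧
        ∀ i : ℕ, 2 * i + 1 < l.length →
          l.getD (2 * i + 1) 0 < l.getD (2 * i) 0 + 2 * j} =
      Nat.card {l : List ℕ // IsComposition n l ∧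
        ∀ x ∈ l, Odd x ∨ (Even x ∧ x ≤ 2 * j)} := by
  refine Nat.card_congr
    { toFun := fun l => ⟨splitPairs l.1,
        ⟨pos_of_mem_splitPairs _ l.2.1.1, (sum_splitPairs _ l.2.1.1).trans l.2.1.2⟩,
        (forall_mem_splitPairs_iff j _ l.2.1.1).2 l.2.2⟩
      invFun := fun l => ⟨mergeOnes 0 l.1, ?_⟩
      left_inv := fun l => Subtype.ext (mergeOnes_splitPairs _ l.2.1.1)
      right_inv := fun l => Subtype.ext (splitPairs_mergeOnes 0 _ l.2.1.1) }
  obtain ⟨l, ⟨hpos, hsum⟩, hparts⟩ := l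
  have hpos' := pos_of_mem_mergeOnes 0 l hpos
  have hinv : splitPairs (mergeOnes 0 l) = l := splitPairs_mergeOnes 0 l hpos
  refine ⟨⟨hpos', ?_⟩, (forall_mem_splitPairs_iff j _ hpos').1 ?_⟩
  · rw [← sum_splitPairs _ hpos', hinv, hsum]
  · rwa [hinv]
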